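/- Fix an integer p ≥ 3 and let λ = 2cos(π/p). A real number α is a fixed point of some element M ≠ ±I of the Hecke group G_p if and only if the complete-quotient sequence (α_j) of its λ-continued fraction is eventually periodic (there exist n ≥ 0 and m ≥ 1 with α_{n+m} = α_n). Moreover, such a fixed point α is parabolic (fixed by some M ∈ G_p with |trace M| = 2, M ≠ ±I) if and only if the eventual period of its partial quotients is, up to cyclic permutation, (2,1,1,…,1) with p−3 ones, and α is hyperbolic (fixed by some M ∈ G_p with |trace M| > 2) if and only if the period is any other sequence. -/

import Mathlib

open Real Matrix Filter

noncomputable section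

/-- `λ_p = 2 cos (π / p)`, the minimal translation length of the Hecke group `G_p`. -/
def heckeLambda (p : ℕ) : ℝ := 2 * Real.cos (Real.pi / p)

/-- The matrix `S = [[1, λ], [0, 1]]`. -/
def Smat (l : ℝ) : Matrix (Fin 2) (Fin 2) ℝ := !![1, l; 0, 1]

/-- The matrix `T = [[0, -1], [1, 0]]`. -/
def Tmat : Matrix (Fin 2) (Fin 2) ℝ := !![0, -1; 1, 0]

/-- The matrix `U = S * T = [[λ, -1], [1, 0]]`. -/
def Umat (l : ℝ) : Matrix (Fin 2) (Fin 2) ℝ := !![l, -1; 1, 0]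

/-- The matrix `S^r = [[1, rλ], [0, 1]]` for an integer exponent `r`. -/
def SmatZ (l : ℝ) (r : ℤ) : Matrix (Fin 2) (Fin 2) ℝ := !![1, (r : ℝ) * l; 0, 1]

/-- Möbius (linear fractional) action of a `2 × 2` real matrix on a real number. -/
def mobius (M : Matrix (Fin 2) (Fin 2) ℝ) (x : ℝ) : ℝ :=
  (M 0 0 * x + M 0 1) / (M 1 0 * x + M 1 1)

/-- `U^k(0)`, the image of `0` under `k` iterations of the linear fractional
transformation `U : x ↦ λ - 1/x`; as a ratio of entries of the matrix power `U^k`. -/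
def Uorbit (l : ℝ) (k : ℕ) : ℝ := ((Umat l) ^ k) 0 1 / ((Umat l) ^ k) 1 1

/-- The complete quotients `α_j` of the (negative) `λ`-continued fraction algorithm:
`α_0 = α`, `α_{j+1} = 1 / (r_j λ - α_j)` with `r_j = ⌊α_j / λ⌋ + 1`. -/
def cq (l α : ℝ) : ℕ → ℝ
  | 0 => α
  | j + 1 => 1 / (((⌊cq l α j / l⌋ : ℝ) + 1) * l - cq l α j)

/-- The partial quotients `r_j = ⌊α_j / λ⌋ + 1` of the `λ`-continued fraction of `α`. -/
def pq (l α : ℝ) (j : ℕ) : ℤ := ⌊cq l α j / l⌋ + 1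

/-- `S` as an element of `SL(2, ℝ)`. -/
def Sgen (l : ℝ) : Matrix.SpecialLinearGroup (Fin 2) ℝ :=
  ⟨!![1, l; 0, 1], by norm_num [Matrix.det_fin_two_of]⟩

/-- `T` as an element of `SL(2, ℝ)`. -/
def Tgen : Matrix.SpecialLinearGroup (Fin 2) ℝ :=
  ⟨!![0, -1; 1, 0], by norm_num [Matrix.det_fin_two_of]⟩

/-- The Hecke group `G_p`, the subgroup of `SL(2, ℝ)` generated by `S` and `T`. -/
def heckeGroup (l : ℝ) : Subgroup (Matrix.SpecialLinearGroup (Fin 2) ℝ) :=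
  Subgroup.closure {Sgen l, Tgen}

/-- `M = [[a, b], [c, d]]` fixes `α` as a linear fractional transformation, i.e.
`α` is a root of `c x² + (d - a) x - b = 0`. -/
def fixesQuad (M : Matrix.SpecialLinearGroup (Fin 2) ℝ) (α : ℝ) : Prop :=
  M.1 1 0 * α ^ 2 + (M.1 1 1 - M.1 0 0) * α - M.1 0 1 = 0

/-- `α` is a hyperbolic fixed point of the Hecke group `G(λ)`. -/
def IsHypFixedPt (l α : ℝ) : Prop :=
  ∃ M ∈ heckeGroup l, 2 < |M.1 0 0 + M.1 1 1| ∧ fixesQuad M α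

/-- `α` is a hyperbolic fixed point of `G(λ)` with Hecke conjugate `α'`
(the other root of the fixed-point quadratic). -/
def IsHypPair (l α α' : ℝ) : Prop :=
  ∃ M ∈ heckeGroup l, 2 < |M.1 0 0 + M.1 1 1| ∧ fixesQuad M α ∧ fixesQuad M α' ∧ α' ≠ α

/-- A hyperbolic fixed point is `G_p`-reduced when its complete-quotient sequence is
purely periodic. -/
def GpReduced (l β : ℝ) : Prop :=
  IsHypFixedPt l β ∧ ∃ m, 1 ≤ m ∧ cq l β m = β

/-- The map `Φ_p : [0, ∞) → [0, ∞)`: `Φ_p(x) = T U^i (x)` when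
`U^{p-i+1}(0) ≤ x < U^{p-i}(0)` for the (unique) `i` with `1 ≤ i ≤ p - 2`,
and `Φ_p(x) = x - λ` when `x ≥ λ`. -/
def Phi (p : ℕ) (l : ℝ) (x : ℝ) : ℝ :=
  @dite ℝ (∃ i : ℕ, 1 ≤ i ∧ i ≤ p - 2 ∧ Uorbit l (p - i + 1) ≤ x ∧ x < Uorbit l (p - i))
    (Classical.propDecidable _)
    (fun h => mobius (Tmat * (Umat l) ^ h.choose) x)
    (fun _ => x - l)

/-- `C_{n-j, n}`: the partial convergents computed by downward recursion,
`C_{n,n} = r_n λ` and `C_{m,n} = r_m λ - 1 / C_{m+1,n}`. -/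
def convAux (l α : ℝ) (n : ℕ) : ℕ → ℝ
  | 0 => (pq l α n : ℝ) * l
  | j + 1 => (pq l α (n - (j + 1)) : ℝ) * l - 1 / convAux l α n j

/-- The `n`-th convergent `C_n = C_{0,n}` of the `λ`-continued fraction of `α`. -/
def conv (l α : ℝ) (n : ℕ) : ℝ := convAux l α n n

/-- The word `S^{r_0} T S^{r_1} T ⋯ S^{r_n} T`. -/
def cfWord (l : ℝ) (r : ℕ → ℤ) (n : ℕ) : Matrix (Fin 2) (Fin 2) ℝ :=
  ((List.range (n + 1)).map fun j => SmatZ l (r j) * Tmat).prod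

/-- The matrix of the step `x ↦ 1 / (rλ - x)` with `r = ⌊x / λ⌋ + 1`. -/
def stepMat (l x : ℝ) : Matrix (Fin 2) (Fin 2) ℝ := !![0, 1; -1, ((⌊x / l⌋ : ℝ) + 1) * l]

/-- The product of the step matrices taking `α` to its `n`-th complete quotient. -/
def accMat (l α : ℝ) : ℕ → Matrix (Fin 2) (Fin 2) ℝ
  | 0 => 1
  | j + 1 => stepMat l (cq l α j) * accMat l α j

/-- The automorphy factor of `accMat l α n` at `α`. -/
def accFactor (l α : ℝ) : ℕ → ℝ
  | 0 => 1
  | j + 1 => (((⌊cq l α j / l⌋ : ℝ) + 1) * l - cq l α j) * accFactor l α j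

/-- The matrix `g` takes `α` to `β`, compatibly (up to a scalar) with the continued fraction
expansions of both, which eventually agree. -/
def TailRel (l α : ℝ) (g : Matrix (Fin 2) (Fin 2) ℝ) (β : ℝ) : Prop :=
  ∃ (n m : ℕ) (ε : ℝ), ε ≠ 0 ∧ cq l α m = cq l β n ∧ accMat l β n * g = ε • accMat l α m

lemma cq_succ (l α : ℝ) (j : ℕ) :
    cq l α (j + 1) = 1 / (((⌊cq l α j / l⌋ : ℝ) + 1) * l - cq l α j) := rfl

lemma cq_add (l α : ℝ) (n k : ℕ) : cq l α (n + k) = cq l (cq l α n) k := by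
  induction k with
  | zero => rfl
  | succ k ih => rw [← add_assoc, cq_succ, cq_succ, ih]

lemma accMat_add (l α : ℝ) (n k : ℕ) :
    accMat l α (n + k) = accMat l (cq l α n) k * accMat l α n := by
  induction k with
  | zero => simp [accMat]
  | succ k ih => rw [← add_assoc, accMat, accMat, ih, cq_add, Matrix.mul_assoc]

lemma det_accMat (l α : ℝ) (n : ℕ) : (accMat l α n).det = 1 := by
  induction n with
  | zero => simp [accMat]
  | succ n ih => rw [accMat, Matrix.det_mul, ih]; simp [stepMat]

lemma step_denom_pos {l : ℝ} (hl : 0 < l) (x : ℝ) : 0 < ((⌊x / l⌋ : ℝ) + 1) * l - x := by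
  have := Int.lt_floor_add_one (x / l)
  rw [div_lt_iff₀ hl] at this
  linarith

lemma cq_pos {l : ℝ} (hl : 0 < l) (α : ℝ) {n : ℕ} (hn : 1 ≤ n) : 0 < cq l α n := by
  obtain ⟨n, rfl⟩ := Nat.exists_eq_add_of_le' hn
  rw [cq_succ]
  exact one_div_pos.2 (step_denom_pos hl _)

lemma accFactor_pos {l : ℝ} (hl : 0 < l) (α : ℝ) (n : ℕ) : 0 < accFactor l α n := by
  induction n with
  | zero => exact one_pos
  | succ n ih => exact mul_pos (step_denom_pos hl _) ih

lemma accMat_mulVec {l : ℝ} (hl : 0 < l) (α : ℝ) (n : ℕ) :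
    accMat l α n *ᵥ ![α, 1] = accFactor l α n • ![cq l α n, 1] := by
  induction n with
  | zero => simp [accMat, accFactor, cq]
  | succ n ih =>
    have h := (step_denom_pos hl (cq l α n)).ne'
    rw [accMat, ← Matrix.mulVec_mulVec, ih, Matrix.mulVec_smul, accFactor, cq_succ, mul_comm,
      mul_smul]
    congr 1
    ext i
    fin_cases i
    · simp [stepMat, Matrix.mulVec, dotProduct, Fin.sum_univ_two, mul_inv_cancel₀ h]
    · simp [stepMat, Matrix.mulVec, dotProduct, Fin.sum_univ_two]
      ring

lemma accFactor_add (l α : ℝ) (n k : ℕ) :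
    accFactor l α (n + k) = accFactor l (cq l α n) k * accFactor l α n := by
  induction k with
  | zero => simp [accFactor]
  | succ k ih => rw [← add_assoc, accFactor, accFactor, ih, cq_add, mul_assoc]

lemma accMat_one (l α : ℝ) : accMat l α 1 = stepMat l α := by
  simp [accMat, cq]

lemma TailRel.of_eq {l α β : ℝ} {g : Matrix (Fin 2) (Fin 2) ℝ} (n m : ℕ)
    (hc : cq l α m = cq l β n) (h : accMat l β n * g = accMat l α m) : TailRel l α g β :=
  ⟨n, m, 1, one_ne_zero, hc, by rw [h, one_smul]⟩

lemma TailRel.trans {l α β γ : ℝ} {g h : Matrix (Fin 2) (Fin 2) ℝ}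
    (h₁ : TailRel l α g β) (h₂ : TailRel l β h γ) : TailRel l α (h * g) γ := by
  obtain ⟨n, m, ε, hε, hc, he⟩ := h₁
  obtain ⟨n', m', ε', hε', hc', he'⟩ := h₂
  refine ⟨n' + n, m + m', ε' * ε, mul_ne_zero hε' hε, ?_, ?_⟩
  · rw [cq_add, cq_add, ← hc', hc, ← cq_add, ← cq_add, add_comm]
  · rw [accMat_add, Matrix.mul_assoc, ← Matrix.mul_assoc _ h g, he', Matrix.smul_mul,
      Matrix.mul_smul, ← Matrix.mul_assoc, ← hc', ← accMat_add, add_comm m' n, accMat_add,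
      Matrix.mul_assoc, he, Matrix.mul_smul, smul_smul, accMat_add, hc]

lemma TailRel.symm {l α β : ℝ} {g g' : Matrix (Fin 2) (Fin 2) ℝ} (hg : g * g' = 1)
    (h : TailRel l α g β) : TailRel l β g' α := by
  obtain ⟨n, m, ε, hε, hc, he⟩ := h
  refine ⟨m, n, ε⁻¹, inv_ne_zero hε, hc.symm, ?_⟩
  have : accMat l β n = ε • (accMat l α m * g') := by
    rw [← Matrix.smul_mul, ← he, Matrix.mul_assoc, hg, Matrix.mul_one]
  rw [this, smul_smul, inv_mul_cancel₀ hε, one_smul]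

lemma TailRel.smul {l α β : ℝ} {g : Matrix (Fin 2) (Fin 2) ℝ} {c : ℝ} (hc0 : c ≠ 0)
    (h : TailRel l α g β) : TailRel l α (c • g) β := by
  obtain ⟨n, m, ε, hε, hc, he⟩ := h
  exact ⟨n, m, c * ε, mul_ne_zero hc0 hε, hc, by rw [Matrix.mul_smul, he, smul_smul]⟩

lemma mulVec_of_accMat_mul_eq {l : ℝ} (hl : 0 < l) {α β ε : ℝ} {n m : ℕ}
    {g : Matrix (Fin 2) (Fin 2) ℝ} (hc : cq l α m = cq l β n)
    (he : accMat l β n * g = ε • accMat l α m) :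
    g *ᵥ ![α, 1] = (ε * accFactor l α m / accFactor l β n) • ![β, 1] := by
  have hq := (accFactor_pos hl β n).ne'
  have key : accMat l β n *ᵥ (g *ᵥ ![α, 1]) =
      accMat l β n *ᵥ ((ε * accFactor l α m / accFactor l β n) • ![β, 1]) := by
    rw [Matrix.mulVec_mulVec, he, Matrix.smul_mulVec, accMat_mulVec hl, Matrix.mulVec_smul,
      accMat_mulVec hl, hc, smul_smul, smul_smul, div_mul_cancel₀ _ hq]
  have hu : IsUnit (accMat l β n) := by
    rw [Matrix.isUnit_iff_isUnit_det, det_accMat]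
    exact isUnit_one
  exact Matrix.mulVec_injective_of_isUnit hu key

lemma TailRel.mulVec {l : ℝ} (hl : 0 < l) {α β : ℝ} {g : Matrix (Fin 2) (Fin 2) ℝ}
    (h : TailRel l α g β) : ∃ t : ℝ, t ≠ 0 ∧ g *ᵥ ![α, 1] = t • ![β, 1] := by
  obtain ⟨n, m, ε, hε, hc, he⟩ := h
  exact ⟨_, div_ne_zero (mul_ne_zero hε (accFactor_pos hl α m).ne') (accFactor_pos hl β n).ne',
    mulVec_of_accMat_mul_eq hl hc he⟩

lemma floor_add_self_div {l : ℝ} (hl : 0 < l) (x : ℝ) : ⌊(x + l) / l⌋ = ⌊x / l⌋ + 1 := by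
  rw [add_div, div_self hl.ne', Int.floor_add_one]

lemma cq_one_add_self {l : ℝ} (hl : 0 < l) (x : ℝ) : cq l (x + l) 1 = cq l x 1 := by
  simp only [cq, floor_add_self_div hl]
  push_cast
  ring_nf

lemma tailRel_S {l : ℝ} (hl : 0 < l) (x : ℝ) : TailRel l x (Smat l) (x + l) := by
  refine TailRel.of_eq 1 1 (cq_one_add_self hl x).symm ?_
  rw [accMat_one, accMat_one, stepMat, stepMat, Smat, floor_add_self_div hl]
  ext i j
  fin_cases i <;> fin_cases j <;> simp [Matrix.mul_apply, Fin.sum_univ_two]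
  ring

lemma tailRel_S_inv {l : ℝ} (hl : 0 < l) (x : ℝ) : TailRel l x !![1, -l; 0, 1] (x - l) := by
  have h := tailRel_S hl (x - l)
  rw [sub_add_cancel] at h
  refine h.symm ?_
  ext i j
  fin_cases i <;> fin_cases j <;> simp [Smat, Matrix.mul_apply, Fin.sum_univ_two]

/-- `sin (x π / p) / sin (π / p)`. -/
def sinQuot (p : ℕ) (x : ℝ) : ℝ := Real.sin (x * (π / p)) / Real.sin (π / p)

lemma sin_pi_div_pos {p : ℕ} (hp : 3 ≤ p) : 0 < Real.sin (π / p) := by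
  have h3 : (3 : ℝ) ≤ p := by exact_mod_cast hp
  exact Real.sin_pos_of_pos_of_lt_pi (by positivity) (div_lt_self Real.pi_pos (by linarith))

lemma one_le_heckeLambda {p : ℕ} (hp : 3 ≤ p) : 1 ≤ heckeLambda p := by
  have h3 : (3 : ℝ) ≤ p := by exact_mod_cast hp
  have : Real.cos (π / 3) ≤ Real.cos (π / p) := by
    apply Real.cos_le_cos_of_nonneg_of_le_pi (by positivity)
    · linarith [Real.pi_pos]
    · exact div_le_div_of_nonneg_left Real.pi_pos.le (by norm_num) h3
  rw [Real.cos_pi_div_three] at this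
  rw [heckeLambda]
  linarith

lemma heckeLambda_pos {p : ℕ} (hp : 3 ≤ p) : 0 < heckeLambda p :=
  one_pos.trans_le (one_le_heckeLambda hp)

lemma heckeLambda_lt_two {p : ℕ} (hp : 3 ≤ p) : heckeLambda p < 2 := by
  have h := sin_pi_div_pos hp
  have h1 := Real.sin_sq_add_cos_sq (π / p)
  have h2 := one_le_heckeLambda hp
  rw [heckeLambda] at *
  nlinarith

lemma sinQuot_add_one (p : ℕ) (x : ℝ) :
    sinQuot p (x + 1) = heckeLambda p * sinQuot p x - sinQuot p (x - 1) := by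
  simp only [sinQuot, heckeLambda, add_mul, sub_mul, one_mul, Real.sin_add, Real.sin_sub]
  ring

lemma sinQuot_zero (p : ℕ) : sinQuot p 0 = 0 := by simp [sinQuot]

lemma sinQuot_one {p : ℕ} (hp : 3 ≤ p) : sinQuot p 1 = 1 := by
  simp [sinQuot, (sin_pi_div_pos hp).ne']

lemma sinQuot_neg_one {p : ℕ} (hp : 3 ≤ p) : sinQuot p (-1) = -1 := by
  simp [sinQuot, (sin_pi_div_pos hp).ne']

lemma sinQuot_self {p : ℕ} (hp : 3 ≤ p) : sinQuot p p = 0 := by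
  have h0 : (p : ℝ) ≠ 0 := by positivity
  simp [sinQuot, mul_div_cancel₀ _ h0]

lemma sinQuot_self_sub_one {p : ℕ} (hp : 3 ≤ p) : sinQuot p (p - 1) = 1 := by
  have h0 : (p : ℝ) ≠ 0 := by positivity
  simp [sinQuot, sub_mul, mul_div_cancel₀ _ h0, Real.sin_pi_sub, (sin_pi_div_pos hp).ne']

lemma sinQuot_self_sub_two {p : ℕ} (hp : 3 ≤ p) : sinQuot p (p - 2) = heckeLambda p := by
  have h := sinQuot_add_one p (p - 1)
  rw [sub_add_cancel, sinQuot_self hp, sinQuot_self_sub_one hp, sub_sub, one_add_one_eq_two] at h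
  linarith

lemma sinQuot_self_sub_three {p : ℕ} (hp : 3 ≤ p) :
    sinQuot p (p - 3) = heckeLambda p ^ 2 - 1 := by
  have h := sinQuot_add_one p (p - 2)
  rw [show (p : ℝ) - 2 + 1 = p - 1 by ring, show (p : ℝ) - 2 - 1 = p - 3 by ring,
    sinQuot_self_sub_one hp, sinQuot_self_sub_two hp] at h
  linarith

lemma sinQuot_pos {p : ℕ} (hp : 3 ≤ p) {x : ℝ} (h0 : 0 < x) (h1 : x < p) : 0 < sinQuot p x := by
  have hp0 : (0 : ℝ) < p := by positivity
  refine div_pos (Real.sin_pos_of_pos_of_lt_pi (by positivity) ?_) (sin_pi_div_pos hp)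
  rw [mul_div_assoc', div_lt_iff₀ hp0, mul_comm]
  gcongr

lemma sinQuot_nonneg {p : ℕ} (hp : 3 ≤ p) {x : ℝ} (h0 : 0 ≤ x) (h1 : x < p) :
    0 ≤ sinQuot p x := by
  rcases h0.eq_or_lt with rfl | h
  · rw [sinQuot_zero]
  · exact (sinQuot_pos hp h h1).le

/-- Along a run of partial quotients equal to `1`, the complete quotients are ratios of
consecutive terms of a solution of the recurrence of `sinQuot`. -/
lemma cq_of_floor_eq_zero {p : ℕ} (hp : 3 ≤ p) (y : ℝ) (K : ℕ)
    (h : ∀ k < K, ⌊cq (heckeLambda p) y k / heckeLambda p⌋ = 0) :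
    0 < sinQuot p (K + 1) - sinQuot p K * y ∧
    cq (heckeLambda p) y K =
      (sinQuot p K - sinQuot p (K - 1) * y) / (sinQuot p (K + 1) - sinQuot p K * y) ∧
    accMat (heckeLambda p) y K =
      !![-sinQuot p (K - 1), sinQuot p K; -sinQuot p K, sinQuot p (K + 1)] := by
  have hl := heckeLambda_pos hp
  induction K with
  | zero =>
    refine ⟨?_, ?_, ?_⟩
    · simp [sinQuot_zero, sinQuot_one hp]
    · simp [sinQuot_zero, sinQuot_one hp, sinQuot_neg_one hp, cq]
    · simp [sinQuot_zero, sinQuot_one hp, sinQuot_neg_one hp, accMat, Matrix.one_fin_two]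
  | succ K ih =>
    obtain ⟨hpos, hcq, hacc⟩ := ih fun k hk => h k (hk.trans K.lt_succ_self)
    have hf := h K K.lt_succ_self
    have hden := step_denom_pos hl (cq (heckeLambda p) y K)
    have hs := cq_succ (heckeLambda p) y K
    have h1 := sinQuot_add_one p K
    have h2 := sinQuot_add_one p (K + 1)
    rw [add_sub_cancel_right] at h2
    push_cast
    rw [add_sub_cancel_right]
    rw [hf, hcq] at hden
    rw [hf, hcq] at hs
    have e : ((0 : ℤ) + 1 : ℝ) * heckeLambda p -
        (sinQuot p K - sinQuot p (K - 1) * y) / (sinQuot p (K + 1) - sinQuot p K * y) =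
        (sinQuot p (K + 1 + 1) - sinQuot p (K + 1) * y) /
          (sinQuot p (K + 1) - sinQuot p K * y) := by
      rw [eq_div_iff hpos.ne', sub_mul, div_mul_cancel₀ _ hpos.ne', h2]
      push_cast
      linear_combination y * h1
    rw [e] at hden hs
    have hpos' := (div_pos_iff_of_pos_right hpos).1 hden
    refine ⟨hpos', by rw [hs, one_div_div], ?_⟩
    rw [accMat, hacc, stepMat, hf, h2]
    ext i j
    fin_cases i <;> fin_cases j <;> simp [Matrix.mul_apply, Fin.sum_univ_two, h1] <;> ring

lemma floor_cq_eq_zero {p : ℕ} (hp : 3 ≤ p) {y : ℝ} (hy : 0 ≤ y) (hy1 : heckeLambda p * y < 1)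
    (k : ℕ) (hk : k < p - 2) : ⌊cq (heckeLambda p) y k / heckeLambda p⌋ = 0 := by
  induction k using Nat.strong_induction_on with
  | _ k ih =>
    have hl := heckeLambda_pos hp
    obtain ⟨hpos, hcq, -⟩ := cq_of_floor_eq_zero hp y k fun j hj => ih j hj (hj.trans hk)
    have hk' : (k : ℝ) + 2 < p := by
      have : k + 2 < p := by omega
      exact_mod_cast this
    have hk0 : (0 : ℝ) ≤ k := by positivity
    have h1 := sinQuot_add_one p k
    have h2 := sinQuot_add_one p (k + 1)
    rw [add_sub_cancel_right] at h2
    rw [Int.floor_eq_zero_iff, Set.mem_Ico, div_lt_one hl]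
    constructor
    · rcases k.eq_zero_or_pos with rfl | h0
      · exact div_nonneg hy hl.le
      · exact div_nonneg (cq_pos hl y h0).le hl.le
    · rw [hcq, div_lt_iff₀ hpos]
      have key : 0 < sinQuot p (k + 1 + 1) - sinQuot p (k + 1) * y := by
        have hnext : 0 ≤ sinQuot p (k + 1 + 1 + 1) := by
          rcases eq_or_lt_of_le (show (k : ℝ) + 1 + 1 + 1 ≤ p by
            have : k + 1 + 1 + 1 ≤ p := by omega
            exact_mod_cast this) with h | h
          · rw [h, sinQuot_self hp]
          · exact sinQuot_nonneg hp (by positivity) h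
        have h3 := sinQuot_add_one p (k + 1 + 1)
        rw [add_sub_cancel_right] at h3
        have h4 : 0 < sinQuot p (k + 1) := sinQuot_pos hp (by positivity) (by linarith)
        have : 0 < heckeLambda p * (sinQuot p (k + 1 + 1) - sinQuot p (k + 1) * y) := by
          nlinarith
        exact pos_of_mul_pos_right this hl.le
      rw [h2] at key
      nlinarith

lemma cq_sub_two {p : ℕ} (hp : 3 ≤ p) {y : ℝ}
    (h : ∀ k < p - 2, ⌊cq (heckeLambda p) y k / heckeLambda p⌋ = 0) :
    0 < 1 - heckeLambda p * y ∧
    cq (heckeLambda p) y (p - 2) = y / (1 - heckeLambda p * y) + heckeLambda p ∧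
    accMat (heckeLambda p) y (p - 2) =
      !![1 - heckeLambda p ^ 2, heckeLambda p; -heckeLambda p, 1] := by
  obtain ⟨hpos, hcq, hacc⟩ := cq_of_floor_eq_zero hp y (p - 2) h
  have e : ((p - 2 : ℕ) : ℝ) = p - 2 := by
    rw [Nat.cast_sub (by omega)]
    norm_num
  rw [e, show (p : ℝ) - 2 + 1 = p - 1 by ring, sinQuot_self_sub_one hp,
    sinQuot_self_sub_two hp] at hpos
  rw [e, show (p : ℝ) - 2 + 1 = p - 1 by ring, show (p : ℝ) - 2 - 1 = p - 3 by ring,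
    sinQuot_self_sub_one hp, sinQuot_self_sub_two hp, sinQuot_self_sub_three hp] at hcq hacc
  refine ⟨hpos, ?_, ?_⟩
  · rw [hcq, div_add' _ _ _ hpos.ne']
    ring_nf
  · rw [hacc, neg_sub]

lemma tailRel_lower {p : ℕ} (hp : 3 ≤ p) {y : ℝ} (hy : 0 ≤ y) (hy1 : heckeLambda p * y < 1) :
    TailRel (heckeLambda p) y !![1, 0; -heckeLambda p, 1] (y / (1 - heckeLambda p * y)) := by
  have hl := heckeLambda_pos hp
  obtain ⟨-, hcq, hacc⟩ := cq_sub_two hp (floor_cq_eq_zero hp hy hy1)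
  refine TailRel.of_eq 1 (p - 2 + 1) ?_ ?_
  · rw [cq_add, hcq, cq_one_add_self hl]
  · rw [accMat_add, accMat_one, accMat_one, hcq, hacc, stepMat, stepMat, floor_add_self_div hl]
    ext i j
    fin_cases i <;> fin_cases j <;> simp [Matrix.mul_apply, Fin.sum_univ_two] <;> ring

lemma tailRel_T_of_pos {p : ℕ} (hp : 3 ≤ p) (k : ℕ) (x : ℝ) (hx : 0 < x)
    (hk : 1 / x ≤ k * heckeLambda p) : TailRel (heckeLambda p) x Tmat (-1 / x) := by
  have hl := heckeLambda_pos hp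
  induction k generalizing x with
  | zero =>
    have := one_div_pos.2 hx
    simp at hk
    linarith
  | succ k ih =>
    by_cases h : 1 / x ≤ heckeLambda p
    · have hf : ⌊-1 / x / heckeLambda p⌋ = -1 := by
        rw [Int.floor_eq_iff, le_div_iff₀ hl, div_lt_iff₀ hl, neg_div]
        have := one_div_pos.2 hx
        push_cast
        constructor <;> linarith
      refine TailRel.of_eq 1 0 ?_ ?_
      · rw [cq_succ, cq, cq, hf]
        simp [neg_div]
      · rw [accMat_one, accMat, stepMat, hf, Tmat]
        ext i j
        fin_cases i <;> fin_cases j <;> simp [Matrix.mul_apply, Fin.sum_univ_two]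
    · rw [not_le, lt_div_iff₀ hx] at h
      have hpos : 0 < 1 - heckeLambda p * x := by linarith
      have e : 1 / (x / (1 - heckeLambda p * x)) = 1 / x - heckeLambda p := by
        field_simp
      have h1 := ih (x / (1 - heckeLambda p * x)) (by positivity) (by
        rw [e]
        push_cast at hk
        linarith)
      have h2 := ((tailRel_lower hp hx.le h).trans h1).trans (tailRel_S_inv hl _)
      convert h2 using 1
      · ext i j
        fin_cases i <;> fin_cases j <;> simp [Tmat, Matrix.mul_apply, Fin.sum_univ_two]
      · rw [neg_div, neg_div, e]
        ring

lemma Tmat_mul_self : Tmat * Tmat = -1 := by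
  ext i j
  fin_cases i <;> fin_cases j <;> simp [Tmat, Matrix.mul_apply, Fin.sum_univ_two]

lemma TailRel.neg {l α β : ℝ} {g : Matrix (Fin 2) (Fin 2) ℝ} (h : TailRel l α g β) :
    TailRel l α (-g) β := by
  have := h.smul (c := -1) (by norm_num)
  rwa [neg_one_smul] at this

lemma tailRel_T {p : ℕ} (hp : 3 ≤ p) {x : ℝ} (hx : x ≠ 0) :
    TailRel (heckeLambda p) x Tmat (-1 / x) := by
  have hl := heckeLambda_pos hp
  have key : ∀ x : ℝ, 0 < x → TailRel (heckeLambda p) x Tmat (-1 / x) := fun x hx => by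
    obtain ⟨k, hk⟩ := exists_nat_ge (1 / x / heckeLambda p)
    exact tailRel_T_of_pos hp k x hx ((div_le_iff₀ hl).1 hk)
  rcases hx.lt_or_gt with h | h
  · have h1 := key (-1 / x) (div_pos_of_neg_of_neg (by norm_num) h)
    rw [show -1 / (-1 / x) = x by field_simp] at h1
    have h2 := (h1.symm (g' := -Tmat) (by rw [Matrix.mul_neg, Tmat_mul_self, neg_neg])).neg
    rwa [neg_neg] at h2
  · exact key x h

/-- `g` takes `α` to a real number compatibly with continued fractions, or it takes `α` to `∞`
and `T * g` takes it to `0` compatibly with continued fractions. -/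
def Tracks (l α : ℝ) (g : Matrix (Fin 2) (Fin 2) ℝ) : Prop :=
  (∃ β, TailRel l α g β) ∨ TailRel l α (Tmat * g) 0

lemma Tracks.T_mul {p : ℕ} (hp : 3 ≤ p) {α : ℝ} {g : Matrix (Fin 2) (Fin 2) ℝ}
    (h : Tracks (heckeLambda p) α g) : Tracks (heckeLambda p) α (Tmat * g) := by
  rcases h with ⟨β, h⟩ | h
  · by_cases hβ : β = 0
    · subst hβ
      right
      rw [← Matrix.mul_assoc, Tmat_mul_self, Matrix.neg_mul, Matrix.one_mul]
      exact h.neg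
    · exact Or.inl ⟨_, h.trans (tailRel_T hp hβ)⟩
  · exact Or.inl ⟨0, h⟩

lemma Tracks.neg {l α : ℝ} {g : Matrix (Fin 2) (Fin 2) ℝ} (h : Tracks l α g) :
    Tracks l α (-g) := by
  rcases h with ⟨β, h⟩ | h
  · exact Or.inl ⟨β, h.neg⟩
  · exact Or.inr (by rw [Matrix.mul_neg]; exact h.neg)

lemma tailRel_lower_zero {p : ℕ} (hp : 3 ≤ p) :
    TailRel (heckeLambda p) 0 !![1, 0; -heckeLambda p, 1] 0 := by
  simpa using tailRel_lower hp le_rfl (by simp : heckeLambda p * 0 < 1)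

lemma Tracks.S_mul {p : ℕ} (hp : 3 ≤ p) {α : ℝ} {g : Matrix (Fin 2) (Fin 2) ℝ}
    (h : Tracks (heckeLambda p) α g) :
    Tracks (heckeLambda p) α (Smat (heckeLambda p) * g) := by
  rcases h with ⟨β, h⟩ | h
  · exact Or.inl ⟨_, h.trans (tailRel_S (heckeLambda_pos hp) β)⟩
  · right
    convert h.trans (tailRel_lower_zero hp) using 1
    rw [← Matrix.mul_assoc, ← Matrix.mul_assoc]
    congr 1
    ext i j
    fin_cases i <;> fin_cases j <;> simp [Tmat, Smat, Matrix.mul_apply, Fin.sum_univ_two]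

lemma Tracks.S_inv_mul {p : ℕ} (hp : 3 ≤ p) {α : ℝ} {g : Matrix (Fin 2) (Fin 2) ℝ}
    (h : Tracks (heckeLambda p) α g) :
    Tracks (heckeLambda p) α (!![1, -heckeLambda p; 0, 1] * g) := by
  rcases h with ⟨β, h⟩ | h
  · exact Or.inl ⟨_, h.trans (tailRel_S_inv (heckeLambda_pos hp) β)⟩
  · right
    have h0 : TailRel (heckeLambda p) 0 !![1, 0; heckeLambda p, 1] 0 :=
      (tailRel_lower_zero hp).symm (by
        ext i j
        fin_cases i <;> fin_cases j <;> simp [Matrix.mul_apply, Fin.sum_univ_two])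
    convert h.trans h0 using 1
    rw [← Matrix.mul_assoc, ← Matrix.mul_assoc]
    congr 1
    ext i j
    fin_cases i <;> fin_cases j <;> simp [Tmat, Matrix.mul_apply, Fin.sum_univ_two]

lemma Tgen_inv : (Tgen⁻¹).1 = -Tmat := by
  rw [Matrix.SpecialLinearGroup.coe_inv, Tgen, Matrix.adjugate_fin_two_of]
  simp [Tmat]

lemma Sgen_inv (l : ℝ) : ((Sgen l)⁻¹).1 = !![1, -l; 0, 1] := by
  rw [Matrix.SpecialLinearGroup.coe_inv, Sgen, Matrix.adjugate_fin_two_of]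
  simp

lemma tracks_of_mem {p : ℕ} (hp : 3 ≤ p) (α : ℝ) {M : Matrix.SpecialLinearGroup (Fin 2) ℝ}
    (hM : M ∈ heckeGroup (heckeLambda p)) : Tracks (heckeLambda p) α M.1 := by
  induction hM using Subgroup.closure_induction_left with
  | one => exact Or.inl ⟨α, TailRel.of_eq 0 0 rfl (by simp)⟩
  | mul_left x hx y hy ih =>
    rw [Matrix.SpecialLinearGroup.coe_mul]
    rcases hx with rfl | rfl
    · exact ih.S_mul hp
    · exact ih.T_mul hp
  | inv_mul_cancel x hx y hy ih =>
    rw [Matrix.SpecialLinearGroup.coe_mul]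
    rcases hx with rfl | rfl
    · rw [Sgen_inv]
      exact ih.S_inv_mul hp
    · rw [Tgen_inv, Matrix.neg_mul]
      exact (ih.T_mul hp).neg

lemma fixesQuad_iff (M : Matrix.SpecialLinearGroup (Fin 2) ℝ) (α : ℝ) :
    fixesQuad M α ↔ M.1 *ᵥ ![α, 1] = (M.1 1 0 * α + M.1 1 1) • ![α, 1] := by
  constructor
  · intro h
    rw [fixesQuad] at h
    ext i
    fin_cases i
    · simp [Matrix.mulVec, dotProduct, Fin.sum_univ_two]
      linarith
    · simp [Matrix.mulVec, dotProduct, Fin.sum_univ_two]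
  · intro h
    have h0 := congrFun h 0
    simp [Matrix.mulVec, dotProduct, Fin.sum_univ_two] at h0
    rw [fixesQuad]
    linarith

lemma eq_of_mulVec_eq_smul {M : Matrix.SpecialLinearGroup (Fin 2) ℝ} {α μ : ℝ}
    (h : M.1 *ᵥ ![α, 1] = μ • ![α, 1]) : M.1 1 0 * α + M.1 1 1 = μ := by
  have h1 := congrFun h 1
  simpa [Matrix.mulVec, dotProduct, Fin.sum_univ_two] using h1

lemma fixesQuad_of_mulVec_eq_smul {M : Matrix.SpecialLinearGroup (Fin 2) ℝ} {α μ : ℝ}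
    (h : M.1 *ᵥ ![α, 1] = μ • ![α, 1]) : fixesQuad M α := by
  rw [fixesQuad_iff, eq_of_mulVec_eq_smul h, h]

lemma trace_mul_eq {M : Matrix.SpecialLinearGroup (Fin 2) ℝ} {α : ℝ} (h : fixesQuad M α) :
    (M.1 0 0 + M.1 1 1) * (M.1 1 0 * α + M.1 1 1) = (M.1 1 0 * α + M.1 1 1) ^ 2 + 1 := by
  have hd := M.2
  rw [Matrix.det_fin_two] at hd
  rw [fixesQuad] at h
  linear_combination hd - M.1 1 0 * h

lemma abs_trace_eq_two_iff {M : Matrix.SpecialLinearGroup (Fin 2) ℝ} {α : ℝ}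
    (h : fixesQuad M α) :
    |M.1 0 0 + M.1 1 1| = 2 ↔ (M.1 1 0 * α + M.1 1 1) ^ 2 = 1 := by
  have ht := trace_mul_eq h
  generalize M.1 0 0 + M.1 1 1 = t at *
  generalize M.1 1 0 * α + M.1 1 1 = μ at *
  rw [← abs_of_pos (two_pos (α := ℝ)), ← sq_eq_sq_iff_abs_eq_abs]
  have key : (t ^ 2 - 2 ^ 2) * μ ^ 2 = (μ ^ 2 - 1) ^ 2 := by
    linear_combination (t * μ + μ ^ 2 + 1) * ht
  constructor
  · intro h
    rw [h, sub_self, zero_mul] at key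
    exact sub_eq_zero.1 (pow_eq_zero_iff two_ne_zero |>.1 key.symm)
  · intro h
    rw [h] at key
    linarith

lemma two_lt_abs_trace_iff {M : Matrix.SpecialLinearGroup (Fin 2) ℝ} {α : ℝ}
    (h : fixesQuad M α) :
    2 < |M.1 0 0 + M.1 1 1| ↔ (M.1 1 0 * α + M.1 1 1) ^ 2 ≠ 1 := by
  have ht := trace_mul_eq h
  rw [ne_eq, ← abs_trace_eq_two_iff h]
  generalize M.1 0 0 + M.1 1 1 = t at *
  generalize M.1 1 0 * α + M.1 1 1 = μ at *
  have key : 2 ≤ |t| := by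
    have hμ : 0 < μ ^ 2 := by
      refine sq_pos_of_ne_zero fun h0 => ?_
      rw [h0] at ht
      norm_num at ht
    have : (t ^ 2 - 2 ^ 2) * μ ^ 2 = (μ ^ 2 - 1) ^ 2 := by
      linear_combination (t * μ + μ ^ 2 + 1) * ht
    have h2 : 0 ≤ t ^ 2 - 2 ^ 2 := nonneg_of_mul_nonneg_left (this ▸ sq_nonneg _) hμ
    rw [← abs_of_pos (two_pos (α := ℝ)), ← sq_le_sq]
    linarith
  exact ⟨fun h => h.ne', fun h => lt_of_le_of_ne key (Ne.symm h)⟩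

lemma exists_cq_eq_of_fixesQuad {p : ℕ} (hp : 3 ≤ p) {α : ℝ}
    {M : Matrix.SpecialLinearGroup (Fin 2) ℝ} (hM : M ∈ heckeGroup (heckeLambda p))
    (hfix : fixesQuad M α) :
    ∃ n m : ℕ, 1 ≤ n ∧ 1 ≤ m ∧ cq (heckeLambda p) α m = cq (heckeLambda p) α n ∧
      (n = m → M.1 = 1 ∨ M.1 = -1) ∧
      (M.1 1 0 * α + M.1 1 1) ^ 2 * accFactor (heckeLambda p) α n ^ 2 =
        accFactor (heckeLambda p) α m ^ 2 := by
  have hl := heckeLambda_pos hp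
  have hv := (fixesQuad_iff M α).1 hfix
  have hrel : TailRel (heckeLambda p) α M.1 α := by
    rcases tracks_of_mem hp α hM with ⟨β, h⟩ | h
    · obtain ⟨t, ht, he⟩ := h.mulVec hl
      rw [hv] at he
      have h0 := congrFun he 0
      have h1 := congrFun he 1
      simp only [Pi.smul_apply, Matrix.cons_val_zero, Matrix.cons_val_one, smul_eq_mul,
        mul_one] at h0 h1
      rw [h1] at h0
      rwa [← mul_left_cancel₀ ht h0] at h
    · obtain ⟨t, ht, he⟩ := h.mulVec hl
      rw [← Matrix.mulVec_mulVec, hv, Matrix.mulVec_smul] at he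
      have h0 := congrFun he 0
      have h1 := congrFun he 1
      simp [Tmat] at h0 h1
      have h2 : M.1 1 0 * α + M.1 1 1 = 0 := by linarith
      exact absurd (by rw [← h1, h2, zero_mul]) ht
  obtain ⟨n, m, ε, -, hc, he⟩ := hrel
  have hc' : cq (heckeLambda p) α (m + 1) = cq (heckeLambda p) α (n + 1) := by
    rw [cq_add, cq_add, hc]
  have he' : accMat (heckeLambda p) α (n + 1) * M.1 = ε • accMat (heckeLambda p) α (m + 1) := by
    rw [accMat, accMat, Matrix.mul_assoc, he, Matrix.mul_smul, hc]
  have hε : ε ^ 2 = 1 := by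
    have := congrArg Matrix.det he
    rw [Matrix.det_mul, det_accMat, Matrix.det_smul, det_accMat, M.2] at this
    simpa using this.symm
  refine ⟨n + 1, m + 1, by omega, by omega, hc', ?_, ?_⟩
  · intro hnm
    rw [← hnm] at he'
    have hu : IsUnit (accMat (heckeLambda p) α (n + 1)) := by
      rw [Matrix.isUnit_iff_isUnit_det, det_accMat]
      exact isUnit_one
    have h1 : M.1 = ε • (1 : Matrix (Fin 2) (Fin 2) ℝ) := by
      apply hu.mul_left_cancel
      rw [he', Matrix.mul_smul, Matrix.mul_one]
    rcases sq_eq_one_iff.1 hε with rfl | rfl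
    · left; rw [h1, one_smul]
    · right; rw [h1, neg_one_smul]
  · have h1 := eq_of_mulVec_eq_smul (mulVec_of_accMat_mul_eq hl hc' he')
    have hq := (accFactor_pos hl α (n + 1)).ne'
    rw [h1, ← mul_pow, div_mul_cancel₀ _ hq, mul_pow, hε, one_mul]

/-- The invariant quadratic form of the elliptic element `U`, transported along the
continued fraction; it does not increase. -/
def potential (l α : ℝ) (n : ℕ) : ℝ :=
  accFactor l α n ^ 2 * (cq l α n ^ 2 - l * cq l α n + 1)

lemma potential_succ {l : ℝ} (hl : 0 < l) (α : ℝ) (n : ℕ) :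
    potential l α n - potential l α (n + 1) = accFactor l α n ^ 2 *
      (⌊cq l α n / l⌋ * l * (2 * cq l α n - (⌊cq l α n / l⌋ + 1) * l)) := by
  have h := (step_denom_pos hl (cq l α n)).ne'
  rw [potential, potential, accFactor, cq_succ]
  generalize (⌊cq l α n / l⌋ : ℝ) = k at *
  generalize hd : (k + 1) * l - cq l α n = d at *
  have hx : cq l α n = (k + 1) * l - d := by linarith
  rw [hx]
  field_simp
  ring

lemma potential_gap {l : ℝ} (hl : 0 < l) {x : ℝ} (hx : 0 ≤ x) :
    (⌊x / l⌋ = 0 ∨ x = l ∧ (⌊x / l⌋ : ℝ) * l * (2 * x - (⌊x / l⌋ + 1) * l) = 0) ∨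
      0 < (⌊x / l⌋ : ℝ) * l * (2 * x - (⌊x / l⌋ + 1) * l) := by
  have h0 : 0 ≤ ⌊x / l⌋ := Int.floor_nonneg.2 (by positivity)
  have h1 : (⌊x / l⌋ : ℝ) * l ≤ x := (le_div_iff₀ hl).1 (Int.floor_le _)
  rcases h0.eq_or_lt with h | h
  · exact Or.inl (Or.inl h.symm)
  · have h2 : (1 : ℝ) ≤ ⌊x / l⌋ := by exact_mod_cast h
    by_cases hxl : x = l
    · left; right
      refine ⟨hxl, ?_⟩
      rw [hxl, div_self hl.ne']
      simp
      ring_nf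
      simp
    · right
      have h3 : l ≤ x := by nlinarith
      have h4 := lt_of_le_of_ne h3 (Ne.symm hxl)
      have : 0 < (⌊x / l⌋ : ℝ) * l := by positivity
      apply mul_pos this
      nlinarith

lemma potential_antitone {l : ℝ} (hl : 0 < l) (α : ℝ) {n m : ℕ} (hn : 1 ≤ n) (h : n ≤ m) :
    potential l α m ≤ potential l α n := by
  induction m, h using Nat.le_induction with
  | base => exact le_rfl
  | succ m hm ih =>
    refine le_trans ?_ ih
    rw [← sub_nonneg, potential_succ hl]
    refine mul_nonneg (sq_nonneg _) ?_
    rcases potential_gap hl (cq_pos hl α (hn.trans hm)).le with (h | ⟨-, h⟩) | h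
    · simp [h]
    · exact h.ge
    · exact h.le

lemma quad_pos {p : ℕ} (hp : 3 ≤ p) (x : ℝ) : 0 < x ^ 2 - heckeLambda p * x + 1 := by
  nlinarith [sq_nonneg (x - heckeLambda p / 2), heckeLambda_lt_two hp, heckeLambda_pos hp]

lemma accFactor_lt_of_cq_eq {p : ℕ} (hp : 3 ≤ p) {α : ℝ} {n m : ℕ} (hn : 1 ≤ n) (hnm : n < m)
    (hc : cq (heckeLambda p) α m = cq (heckeLambda p) α n)
    (h : ∀ j, cq (heckeLambda p) α j ≠ heckeLambda p) :
    accFactor (heckeLambda p) α m ^ 2 < accFactor (heckeLambda p) α n ^ 2 := by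
  have hl := heckeLambda_pos hp
  obtain ⟨j, hnj, hjm, hj⟩ : ∃ j, n ≤ j ∧ j < m ∧
      ⌊cq (heckeLambda p) α j / heckeLambda p⌋ ≠ 0 := by
    by_contra! hcon
    have hmono : ∀ k, n < k → k ≤ m → cq (heckeLambda p) α n < cq (heckeLambda p) α k := by
      have hstep : ∀ j, n ≤ j → j < m →
          cq (heckeLambda p) α j < cq (heckeLambda p) α (j + 1) := fun j hj hjm => by
        have hd := step_denom_pos hl (cq (heckeLambda p) α j)
        rw [cq_succ, lt_div_iff₀ hd]
        rw [hcon j hj hjm]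
        push_cast
        linarith [quad_pos hp (cq (heckeLambda p) α j)]
      intro k hk
      induction k, hk using Nat.le_induction with
      | base => exact fun hm => hstep n le_rfl hm
      | succ k hk ih =>
        exact fun hm => (ih (by omega)).trans (hstep k (by omega) (by omega))
    exact (hmono m hnm le_rfl).ne' hc
  have h1 := potential_antitone hl α hn hnj
  have h2 := potential_antitone hl α (show 1 ≤ j + 1 by omega) hjm
  have h3 : potential (heckeLambda p) α (j + 1) < potential (heckeLambda p) α j := by
    rw [← sub_pos, potential_succ hl]
    refine mul_pos (pow_pos (accFactor_pos hl α j) 2) ?_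
    rcases potential_gap hl (cq_pos hl α (hn.trans hnj)).le with (h' | ⟨h', -⟩) | h'
    · exact absurd h' hj
    · exact absurd h' (h j)
    · exact h'
  have h4 := (h2.trans_lt h3).trans_le h1
  rw [potential, potential, hc] at h4
  exact lt_of_mul_lt_mul_right h4 (quad_pos hp _).le

lemma cq_heckeLambda {p : ℕ} (hp : 3 ≤ p) {j : ℕ} (hj : 1 ≤ j) :
    cq (heckeLambda p) (heckeLambda p) j = cq (heckeLambda p) 0 j := by
  have h := cq_one_add_self (heckeLambda_pos hp) 0
  rw [zero_add] at h
  obtain ⟨k, rfl⟩ := Nat.exists_eq_add_of_le hj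
  rw [cq_add, cq_add, h]

lemma cq_add_period {p : ℕ} (hp : 3 ≤ p) {α : ℝ} {n : ℕ}
    (hn : cq (heckeLambda p) α n = heckeLambda p) (a : ℕ) :
    cq (heckeLambda p) α (n + (p - 2) * a) = heckeLambda p := by
  induction a with
  | zero => exact hn
  | succ a ih =>
    rw [Nat.mul_succ, ← add_assoc, cq_add, ih, cq_heckeLambda hp (by omega),
      (cq_sub_two hp (floor_cq_eq_zero hp le_rfl (by simp))).2.1]
    simp

lemma floor_cq_of_cusp {p : ℕ} (hp : 3 ≤ p) {α : ℝ} {n : ℕ}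
    (hn : cq (heckeLambda p) α n = heckeLambda p) (k : ℕ) :
    (k % (p - 2) = 0 ∧ cq (heckeLambda p) α (n + k) = heckeLambda p) ∨
      (k % (p - 2) ≠ 0 ∧ ⌊cq (heckeLambda p) α (n + k) / heckeLambda p⌋ = 0) := by
  have e : n + k = n + (p - 2) * (k / (p - 2)) + k % (p - 2) := by
    rw [add_assoc, Nat.div_add_mod]
  by_cases h : k % (p - 2) = 0
  · exact Or.inl ⟨h, by rw [e, h, add_zero, cq_add_period hp hn]⟩
  · refine Or.inr ⟨h, ?_⟩
    rw [e, cq_add, cq_add_period hp hn, cq_heckeLambda hp (by omega)]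
    exact floor_cq_eq_zero hp le_rfl (by simp) _ (Nat.mod_lt _ (by omega))

lemma pq_of_cusp {p : ℕ} (hp : 3 ≤ p) {α : ℝ} {n : ℕ}
    (hn : cq (heckeLambda p) α n = heckeLambda p) (j : ℕ) (hj : n ≤ j) :
    pq (heckeLambda p) α j = if (j - n) % (p - 2) = 0 then 2 else 1 := by
  obtain ⟨k, rfl⟩ := Nat.exists_eq_add_of_le hj
  rw [Nat.add_sub_cancel_left, pq]
  rcases floor_cq_of_cusp hp hn k with ⟨h, h'⟩ | ⟨h, h'⟩
  · rw [if_pos h, h', div_self (heckeLambda_pos hp).ne']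
    simp
  · rw [if_neg h, h']
    simp

lemma accFactor_eq_of_cusp {p : ℕ} (hp : 3 ≤ p) {α : ℝ} {N n m : ℕ}
    (hN : cq (heckeLambda p) α N = heckeLambda p)
    (hc : cq (heckeLambda p) α m = cq (heckeLambda p) α n) (hn : N ≤ n) (hm : N ≤ m) :
    accFactor (heckeLambda p) α m ^ 2 = accFactor (heckeLambda p) α n ^ 2 := by
  have hl := heckeLambda_pos hp
  have hconst : ∀ k, N ≤ k → potential (heckeLambda p) α k = potential (heckeLambda p) α N := by
    intro k hk
    induction k, hk using Nat.le_induction with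
    | base => rfl
    | succ k hk ih =>
      rw [← ih, eq_comm, ← sub_eq_zero, potential_succ hl]
      obtain ⟨i, rfl⟩ := Nat.exists_eq_add_of_le hk
      rcases floor_cq_of_cusp hp hN i with ⟨-, h⟩ | ⟨-, h⟩
      · rw [h, div_self hl.ne', Int.floor_one]
        push_cast
        ring
      · rw [h]
        simp
  have h := (hconst m hm).trans (hconst n hn).symm
  rw [potential, potential, hc] at h
  exact mul_right_cancel₀ (quad_pos hp _).ne' h

lemma not_pq_pattern {p : ℕ} (hp : 3 ≤ p) (a : ℕ) (y : ℝ) (hy : 0 < y)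
    (ha : 1 / y ≤ a * heckeLambda p)
    (h : ∀ k, pq (heckeLambda p) (y + heckeLambda p) k = if k % (p - 2) = 0 then 2 else 1) :
    False := by
  have hl := heckeLambda_pos hp
  induction a generalizing y with
  | zero =>
    have := one_div_pos.2 hy
    simp at ha
    linarith
  | succ a ih =>
    have hcq : ∀ k, 1 ≤ k →
        cq (heckeLambda p) (y + heckeLambda p) k = cq (heckeLambda p) y k := by
      intro k hk
      obtain ⟨k, rfl⟩ := Nat.exists_eq_add_of_le hk
      rw [cq_add, cq_add, cq_one_add_self hl]
    have hfl : ∀ k < p - 2, ⌊cq (heckeLambda p) y k / heckeLambda p⌋ = 0 := by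
      intro k hk
      have := h k
      rw [pq, Nat.mod_eq_of_lt hk] at this
      rcases k.eq_zero_or_pos with rfl | h0
      · rw [cq, floor_add_self_div hl] at this
        rw [cq]
        simp at this
        omega
      · rw [hcq k h0, if_neg (by omega)] at this
        omega
    obtain ⟨hpos, hlast, -⟩ := cq_sub_two hp hfl
    refine ih (y / (1 - heckeLambda p * y)) (by positivity) ?_ ?_
    · have e : 1 / (y / (1 - heckeLambda p * y)) = 1 / y - heckeLambda p := by
        field_simp
      rw [e]
      push_cast at ha
      linarith
    · intro k
      have := h (p - 2 + k)
      rw [Nat.add_mod_left, pq, cq_add, hcq _ (by omega), hlast] at this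
      exact this

lemma cusp_of_pq {p : ℕ} (hp : 3 ≤ p) {α : ℝ} {n : ℕ}
    (h : ∀ j, n ≤ j → pq (heckeLambda p) α j = if (j - n) % (p - 2) = 0 then 2 else 1) :
    cq (heckeLambda p) α n = heckeLambda p := by
  have hl := heckeLambda_pos hp
  have hfl : ⌊cq (heckeLambda p) α n / heckeLambda p⌋ = 1 := by
    have := h n le_rfl
    rw [pq] at this
    simp at this
    omega
  have hle : heckeLambda p ≤ cq (heckeLambda p) α n := by
    have := (Int.floor_eq_iff.1 hfl).1
    rw [le_div_iff₀ hl] at this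
    simpa using this
  by_contra hne
  have hy : 0 < cq (heckeLambda p) α n - heckeLambda p :=
    sub_pos.2 (lt_of_le_of_ne hle (Ne.symm hne))
  obtain ⟨a, ha⟩ := exists_nat_ge
    (1 / (cq (heckeLambda p) α n - heckeLambda p) / heckeLambda p)
  refine not_pq_pattern hp a _ hy ((div_le_iff₀ hl).1 ha) fun k => ?_
  have := h (n + k) (by omega)
  rw [Nat.add_sub_cancel_left, pq, cq_add] at this
  rw [sub_add_cancel, pq]
  exact this

lemma exists_translation_mem (l : ℝ) (k : ℤ) :
    ∃ g ∈ heckeGroup l, g.1 = !![1, (k : ℝ) * l; 0, 1] := by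
  have hS : Sgen l ∈ heckeGroup l := Subgroup.subset_closure (Or.inl rfl)
  induction k using Int.induction_on with
  | zero => exact ⟨1, one_mem _, by simp [Matrix.one_fin_two]⟩
  | succ k ih =>
    obtain ⟨g, hg, h⟩ := ih
    refine ⟨Sgen l * g, mul_mem hS hg, ?_⟩
    rw [Matrix.SpecialLinearGroup.coe_mul, h, Sgen]
    ext i j
    fin_cases i <;> fin_cases j <;> simp [Matrix.mul_apply, Fin.sum_univ_two]
    ring
  | pred k ih =>
    obtain ⟨g, hg, h⟩ := ih
    refine ⟨(Sgen l)⁻¹ * g, mul_mem (inv_mem hS) hg, ?_⟩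
    rw [Matrix.SpecialLinearGroup.coe_mul, h, Sgen_inv]
    ext i j
    fin_cases i <;> fin_cases j <;> simp [Matrix.mul_apply, Fin.sum_univ_two]
    ring

lemma exists_accMat_mem (l α : ℝ) (n : ℕ) : ∃ g ∈ heckeGroup l, g.1 = accMat l α n := by
  have hT : Tgen ∈ heckeGroup l := Subgroup.subset_closure (Or.inr rfl)
  induction n with
  | zero => exact ⟨1, one_mem _, rfl⟩
  | succ n ih =>
    obtain ⟨g, hg, h⟩ := ih
    obtain ⟨s, hs, h'⟩ := exists_translation_mem l (-(⌊cq l α n / l⌋ + 1))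
    refine ⟨Tgen⁻¹ * s * g, mul_mem (mul_mem (inv_mem hT) hs) hg, ?_⟩
    rw [Matrix.SpecialLinearGroup.coe_mul, Matrix.SpecialLinearGroup.coe_mul, h, h', Tgen_inv,
      accMat]
    congr 1
    ext i j
    fin_cases i <;> fin_cases j <;>
      simp [stepMat, Tmat, Matrix.mul_apply, Fin.sum_univ_two]
    ring

lemma parabolic_of_cusp {p : ℕ} (hp : 3 ≤ p) {α : ℝ} {n : ℕ}
    (hn : cq (heckeLambda p) α n = heckeLambda p) :
    ∃ M ∈ heckeGroup (heckeLambda p),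
      M.1 ≠ 1 ∧ M.1 ≠ -1 ∧ |M.1 0 0 + M.1 1 1| = 2 ∧ fixesQuad M α := by
  have hl := heckeLambda_pos hp
  have hS : Sgen (heckeLambda p) ∈ heckeGroup (heckeLambda p) :=
    Subgroup.subset_closure (Or.inl rfl)
  have hT : Tgen ∈ heckeGroup (heckeLambda p) := Subgroup.subset_closure (Or.inr rfl)
  obtain ⟨a, ha, haM⟩ := exists_accMat_mem (heckeLambda p) α n
  set S := Sgen (heckeLambda p) with hSdef
  set g := Tgen⁻¹ * S⁻¹ * a with hg
  have hgm : g ∈ heckeGroup (heckeLambda p) := mul_mem (mul_mem (inv_mem hT) (inv_mem hS)) ha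
  have hgv : g.1 *ᵥ ![α, 1] = accFactor (heckeLambda p) α n • ![1, 0] := by
    rw [hg, Matrix.SpecialLinearGroup.coe_mul, Matrix.SpecialLinearGroup.coe_mul,
      ← Matrix.mulVec_mulVec, haM, accMat_mulVec hl, hn, Matrix.mulVec_smul, Tgen_inv, Sgen_inv]
    congr 1
    ext i
    fin_cases i <;>
      simp [Tmat, Matrix.mulVec, dotProduct, Fin.sum_univ_two, Matrix.mul_apply]
  have hSe : S.1 *ᵥ ![1, 0] = ![1, 0] := by
    ext i
    fin_cases i <;> simp [hSdef, Sgen, Matrix.mulVec, dotProduct, Fin.sum_univ_two]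
  have hMv : (g⁻¹ * S * g).1 *ᵥ ![α, 1] = (1 : ℝ) • ![α, 1] := by
    rw [Matrix.SpecialLinearGroup.coe_mul, Matrix.SpecialLinearGroup.coe_mul,
      ← Matrix.mulVec_mulVec, ← Matrix.mulVec_mulVec, hgv, Matrix.mulVec_smul, hSe, ← hgv,
      Matrix.mulVec_mulVec, ← Matrix.SpecialLinearGroup.coe_mul, inv_mul_cancel, one_smul,
      Matrix.SpecialLinearGroup.coe_one, Matrix.one_mulVec]
  have hfix := fixesQuad_of_mulVec_eq_smul hMv
  have hconj : ∀ z : Matrix.SpecialLinearGroup (Fin 2) ℝ, z.1 = 1 ∨ z.1 = -1 →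
      g⁻¹ * S * g ≠ z := by
    rintro z hz h
    have h1 : S = g * z * g⁻¹ := by
      rw [← h]
      group
    have h2 : S.1 = z.1 := by
      rw [h1, Matrix.SpecialLinearGroup.coe_mul, Matrix.SpecialLinearGroup.coe_mul]
      rcases hz with hz | hz
      · rw [hz, Matrix.mul_one, ← Matrix.SpecialLinearGroup.coe_mul, mul_inv_cancel]
        rfl
      · rw [hz, Matrix.mul_neg, Matrix.mul_one, Matrix.neg_mul,
          ← Matrix.SpecialLinearGroup.coe_mul, mul_inv_cancel]
        rfl
    have h3 : S.1 0 1 = heckeLambda p := by simp [hSdef, Sgen]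
    rcases hz with hz | hz <;> rw [h2, hz] at h3 <;> simp at h3 <;> exact hl.ne h3
  refine ⟨g⁻¹ * S * g, mul_mem (mul_mem (inv_mem hgm) hS) hgm, fun h => ?_, fun h => ?_, ?_, hfix⟩
  · exact hconj _ (Or.inl h) rfl
  · exact hconj _ (Or.inr h) rfl
  · rw [abs_trace_eq_two_iff hfix, eq_of_mulVec_eq_smul hMv, one_pow]

lemma hyperbolic_of_periodic {p : ℕ} (hp : 3 ≤ p) {α : ℝ} {n m : ℕ} (hm : 1 ≤ m)
    (hc : cq (heckeLambda p) α (n + m) = cq (heckeLambda p) α n)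
    (h : ∀ j, cq (heckeLambda p) α j ≠ heckeLambda p) :
    ∃ M ∈ heckeGroup (heckeLambda p), 2 < |M.1 0 0 + M.1 1 1| ∧ fixesQuad M α := by
  have hl := heckeLambda_pos hp
  have hc' : cq (heckeLambda p) α (n + m + 1) = cq (heckeLambda p) α (n + 1) := by
    rw [cq_add, hc, ← cq_add]
  have hlt := accFactor_lt_of_cq_eq hp (by omega) (by omega) hc' h
  obtain ⟨a, ha, haM⟩ := exists_accMat_mem (heckeLambda p) α (n + 1)
  obtain ⟨b, hb, hbM⟩ := exists_accMat_mem (heckeLambda p) α (n + m + 1)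
  have he : accMat (heckeLambda p) α (n + 1) * (a⁻¹ * b).1 =
      (1 : ℝ) • accMat (heckeLambda p) α (n + m + 1) := by
    rw [← haM, ← hbM, ← Matrix.SpecialLinearGroup.coe_mul, mul_inv_cancel_left, one_smul]
  have hv := mulVec_of_accMat_mul_eq hl hc' he
  have hfix := fixesQuad_of_mulVec_eq_smul hv
  refine ⟨a⁻¹ * b, mul_mem (inv_mem ha) hb, ?_, hfix⟩
  rw [two_lt_abs_trace_iff hfix, eq_of_mulVec_eq_smul hv, one_mul, div_pow]
  exact ((div_lt_one (pow_pos (accFactor_pos hl α _) 2)).2 hlt).ne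

lemma cusp_of_parabolic {p : ℕ} (hp : 3 ≤ p) {α : ℝ}
    {M : Matrix.SpecialLinearGroup (Fin 2) ℝ} (hM : M ∈ heckeGroup (heckeLambda p))
    (h1 : M.1 ≠ 1) (h2 : M.1 ≠ -1) (htr : |M.1 0 0 + M.1 1 1| = 2) (hfix : fixesQuad M α) :
    ∃ n, cq (heckeLambda p) α n = heckeLambda p := by
  obtain ⟨n, m, hn, hm, hc, hnm, hq⟩ := exists_cq_eq_of_fixesQuad hp hM hfix
  rw [(abs_trace_eq_two_iff hfix).1 htr, one_mul] at hq
  by_contra! hcusp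
  rcases lt_trichotomy n m with hlt | heq | hlt
  · exact (accFactor_lt_of_cq_eq hp hn hlt hc hcusp).ne' hq
  · exact (hnm heq).elim h1 h2
  · exact (accFactor_lt_of_cq_eq hp hm hlt hc.symm hcusp).ne hq

lemma periodic_of_fixesQuad {p : ℕ} (hp : 3 ≤ p) {α : ℝ}
    {M : Matrix.SpecialLinearGroup (Fin 2) ℝ} (hM : M ∈ heckeGroup (heckeLambda p))
    (h1 : M.1 ≠ 1) (h2 : M.1 ≠ -1) (hfix : fixesQuad M α) :
    ∃ n m : ℕ, 1 ≤ m ∧ cq (heckeLambda p) α (n + m) = cq (heckeLambda p) α n := by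
  obtain ⟨n, m, -, -, hc, hnm, -⟩ := exists_cq_eq_of_fixesQuad hp hM hfix
  rcases lt_trichotomy n m with hlt | heq | hlt
  · exact ⟨n, m - n, by omega, by rw [Nat.add_sub_cancel' hlt.le, hc]⟩
  · exact ((hnm heq).elim h1 h2).elim
  · exact ⟨m, n - m, by omega, by rw [Nat.add_sub_cancel' hlt.le, hc]⟩

lemma not_cusp_of_hyperbolic {p : ℕ} (hp : 3 ≤ p) {α : ℝ}
    {M : Matrix.SpecialLinearGroup (Fin 2) ℝ} (hM : M ∈ heckeGroup (heckeLambda p))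
    (htr : 2 < |M.1 0 0 + M.1 1 1|) (hfix : fixesQuad M α) (N : ℕ) :
    cq (heckeLambda p) α N ≠ heckeLambda p := by
  intro hN
  have hl := heckeLambda_pos hp
  obtain ⟨n, m, -, -, hc, -, hq⟩ := exists_cq_eq_of_fixesQuad hp hM hfix
  have hc' : cq (heckeLambda p) α (m + N) = cq (heckeLambda p) α (n + N) := by
    rw [cq_add, hc, ← cq_add]
  have h := accFactor_eq_of_cusp hp hN hc' (Nat.le_add_left N n) (Nat.le_add_left N m)
  rw [accFactor_add, accFactor_add _ _ n, hc, mul_pow, mul_pow] at h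
  have h' := mul_left_cancel₀ (pow_pos (accFactor_pos hl _ N) 2).ne' h
  rw [h'] at hq
  exact (two_lt_abs_trace_iff hfix).1 htr
    (mul_right_cancel₀ (pow_pos (accFactor_pos hl α n) 2).ne' (hq.trans (one_mul _).symm))

lemma ne_one_of_hyperbolic {M : Matrix.SpecialLinearGroup (Fin 2) ℝ}
    (htr : 2 < |M.1 0 0 + M.1 1 1|) : M.1 ≠ 1 ∧ M.1 ≠ -1 := by
  constructor <;> intro h <;> rw [h] at htr <;> norm_num at htr

/-- `α` is fixed by some `M ≠ ±I` in `G_p` iff its complete-quotient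
sequence is eventually periodic; it is a parabolic fixed point iff the eventual
period of its partial quotients is, up to cyclic permutation, `(2, 1, …, 1)` with
`p - 3` ones; and it is a hyperbolic fixed point iff the period is any other
sequence. -/
theorem hecke_fixed_point_periodicity (p : ℕ) (hp : 3 ≤ p) (α : ℝ) :
    ((∃ M ∈ heckeGroup (heckeLambda p),
        M.1 ≠ 1 ∧ M.1 ≠ -1 ∧ fixesQuad M α) ↔
      (∃ n m : ℕ, 1 ≤ m ∧ cq (heckeLambda p) α (n + m) = cq (heckeLambda p) α n)) ∧
    ((∃ M ∈ heckeGroup (heckeLambda p),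
        M.1 ≠ 1 ∧ M.1 ≠ -1 ∧ |M.1 0 0 + M.1 1 1| = 2 ∧ fixesQuad M α) ↔
      (∃ n : ℕ, ∀ j : ℕ, n ≤ j →
        pq (heckeLambda p) α j = if (j - n) % (p - 2) = 0 then 2 else 1)) ∧
    ((∃ M ∈ heckeGroup (heckeLambda p),
        2 < |M.1 0 0 + M.1 1 1| ∧ fixesQuad M α) ↔
      ((∃ n m : ℕ, 1 ≤ m ∧
          cq (heckeLambda p) α (n + m) = cq (heckeLambda p) α n) ∧
        ¬ ∃ n : ℕ, ∀ j : ℕ, n ≤ j →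
          pq (heckeLambda p) α j = if (j - n) % (p - 2) = 0 then 2 else 1)) := by
  have tail_iff : (∃ n : ℕ, ∀ j : ℕ, n ≤ j →
      pq (heckeLambda p) α j = if (j - n) % (p - 2) = 0 then 2 else 1) ↔
      ∃ n, cq (heckeLambda p) α n = heckeLambda p :=
    ⟨fun ⟨n, h⟩ => ⟨n, cusp_of_pq hp h⟩, fun ⟨n, h⟩ => ⟨n, pq_of_cusp hp h⟩⟩
  rw [tail_iff]
  refine ⟨⟨?_, ?_⟩, ⟨?_, ?_⟩, ⟨?_, ?_⟩⟩
  · rintro ⟨M, hM, h1, h2, hfix⟩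
    exact periodic_of_fixesQuad hp hM h1 h2 hfix
  · rintro ⟨n, m, hm, hc⟩
    by_cases h : ∃ n, cq (heckeLambda p) α n = heckeLambda p
    · obtain ⟨N, hN⟩ := h
      obtain ⟨M, hM, h1, h2, -, hfix⟩ := parabolic_of_cusp hp hN
      exact ⟨M, hM, h1, h2, hfix⟩
    · obtain ⟨M, hM, htr, hfix⟩ := hyperbolic_of_periodic hp hm hc (not_exists.1 h)
      exact ⟨M, hM, (ne_one_of_hyperbolic htr).1, (ne_one_of_hyperbolic htr).2, hfix⟩
  · rintro ⟨M, hM, h1, h2, htr, hfix⟩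
    exact cusp_of_parabolic hp hM h1 h2 htr hfix
  · rintro ⟨n, hn⟩
    exact parabolic_of_cusp hp hn
  · rintro ⟨M, hM, htr, hfix⟩
    have hne := ne_one_of_hyperbolic htr
    exact ⟨periodic_of_fixesQuad hp hM hne.1 hne.2 hfix,
      not_exists.2 (not_cusp_of_hyperbolic hp hM htr hfix)⟩
  · rintro ⟨⟨n, m, hm, hc⟩, h⟩
    exact hyperbolic_of_periodic hp hm hc (not_exists.1 h)
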